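/- Let n and r be integers with 1 ≤ r < n. Let Z_{n,r} be the set of pairs (π, c) with π ∈ S_{n-1} and c an integer satisfying c = 0, or 1 ≤ c ≤ |Excp_r(π)|, or |Excp_r(π)| + r - 1 < c ≤ n - 1. Then there exists an injection ψ from Z_{n,r} into S_n ∖ S_{n,r} (i.e., every image has at least one r-level grande-fixed place) such that for every (π,c) ∈ Z_{n,r}: exc_r(ψ(π,c)) = exc_r(π) if 0 ≤ c ≤ exc_r(π) + r - 1, and exc_r(ψ(π,c)) = exc_r(π) + 1 otherwise; and den_r(ψ(π,c)) = den_r(π) + c. -/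

import Mathlib

open Finset

/-- The value of the permutation `π ∈ S_n` at the (1-based) position `i`,
in one-line notation with letters `1,…,n`; `0` if `i` is out of range. -/
def pval {n : ℕ} (π : Equiv.Perm (Fin n)) (i : ℕ) : ℕ :=
  if h : 1 ≤ i ∧ i ≤ n then ((π ⟨i - 1, by omega⟩ : Fin n) : ℕ) + 1 else 0

/-- The number of inversions of a word `w`, i.e. pairs of positions `i < j`
with `w_i > w_j`. -/
def winv (w : List ℕ) : ℕ :=
  ((Finset.range w.length ×ˢ Finset.range w.length).filter
    (fun p => p.1 < p.2 ∧ w.getD p.2 0 < w.getD p.1 0)).card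

/-- `rDes(π) = {i ∈ [n-1] : π_i ≥ π_{i+1} + r}`. -/
def rDesSet {n : ℕ} (r : ℕ) (π : Equiv.Perm (Fin n)) : Finset ℕ :=
  (Finset.Icc 1 (n - 1)).filter (fun i => pval π (i + 1) + r ≤ pval π i)

/-- The `r`-descent number `rdes(π)`. -/
def rdes {n : ℕ} (r : ℕ) (π : Equiv.Perm (Fin n)) : ℕ := (rDesSet r π).card

/-- `rInv(π) = {(i,j) : i < j, π_i > π_j, π_i < π_j + r}`. -/
def rInvSet {n : ℕ} (r : ℕ) (π : Equiv.Perm (Fin n)) : Finset (ℕ × ℕ) :=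
  ((Finset.Icc 1 n) ×ˢ (Finset.Icc 1 n)).filter
    (fun p => p.1 < p.2 ∧ pval π p.2 < pval π p.1 ∧ pval π p.1 < pval π p.2 + r)

/-- The `r`-major index `rmaj(π) = ∑_{i ∈ rDes(π)} i + |rInv(π)|`. -/
def rmaj {n : ℕ} (r : ℕ) (π : Equiv.Perm (Fin n)) : ℕ :=
  (∑ i ∈ rDesSet r π, i) + (rInvSet r π).card

/-- The inversion number `inv(π)`: the number of pairs `i < j` with `π_i > π_j`. -/
def invStat {n : ℕ} (π : Equiv.Perm (Fin n)) : ℕ :=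
  (((Finset.Icc 1 n) ×ˢ (Finset.Icc 1 n)).filter
    (fun p => p.1 < p.2 ∧ pval π p.2 < pval π p.1)).card

/-- `Excp_r(π)`: the set of `r`-level excedance places, i.e. indices `i`
with `π_i > i` and `π_i ≥ r`. -/
def excpSet {n : ℕ} (r : ℕ) (π : Equiv.Perm (Fin n)) : Finset ℕ :=
  (Finset.Icc 1 n).filter (fun i => i < pval π i ∧ r ≤ pval π i)

/-- `Exc_r(π)`: the subword of `π` on the `r`-level excedance places,
in increasing order of position. -/
def excWord {n : ℕ} (r : ℕ) (π : Equiv.Perm (Fin n)) : List ℕ :=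
  ((excpSet r π).sort (· ≤ ·)).map (pval π)

/-- `Nexc_r(π)`: the subword of `π` on the non-`r`-level-excedance places,
in increasing order of position. -/
def nexcWord {n : ℕ} (r : ℕ) (π : Equiv.Perm (Fin n)) : List ℕ :=
  (((Finset.Icc 1 n) \ excpSet r π).sort (· ≤ ·)).map (pval π)

/-- The `r`-level Denert statistic
`den_r(π) = ∑_{i ∈ Excp_r(π)} i + inv(Exc_r(π)) + inv(Nexc_r(π))`. -/
def denr {n : ℕ} (r : ℕ) (π : Equiv.Perm (Fin n)) : ℕ :=
  (∑ i ∈ excpSet r π, i) + winv (excWord r π) + winv (nexcWord r π)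

/-- The `r`-level excedance number `exc_r(π) = |{i : π_i > i ≥ r}|`. -/
def excr {n : ℕ} (r : ℕ) (π : Equiv.Perm (Fin n)) : ℕ :=
  ((Finset.Icc 1 n).filter (fun i => r ≤ i ∧ i < pval π i)).card

/-- `i` is a grande-fixed place of `τ`: either `τ_i = i`, or `τ_i > i` and
there is no index `j` with `τ_j > j` and `i ≤ τ_j < τ_i`. -/
def grandeFixedPlace {n : ℕ} (τ : Equiv.Perm (Fin n)) (i : ℕ) : Prop :=
  1 ≤ i ∧ i ≤ n ∧
    (pval τ i = i ∨
      (i < pval τ i ∧ ∀ j, 1 ≤ j → j ≤ n → j < pval τ j →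
        ¬ (i ≤ pval τ j ∧ pval τ j < pval τ i)))

/-- `S_{n,r}`: the set of permutations in `S_n` with no `r`-level grande-fixed
place (a grande-fixed place `i` with `i ≥ r`). -/
def Snr (n r : ℕ) : Set (Equiv.Perm (Fin n)) :=
  {τ | ¬ ∃ i, r ≤ i ∧ grandeFixedPlace τ i}

/-- `S*_{n,r} = {τ ∈ S_{n,r} : τ_r > r}`. -/
def SnrStar (n r : ℕ) : Set (Equiv.Perm (Fin n)) :=
  {τ ∈ Snr n r | r < pval τ r}

/-- `Z_{n,r}`: pairs (π, c) with π ∈ S_{n-1} and c = 0, or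
1 ≤ c ≤ |Excp_r(π)|, or |Excp_r(π)| + r - 1 < c ≤ n - 1. -/
def Znr (n r : ℕ) : Set (Equiv.Perm (Fin (n - 1)) × ℕ) :=
  {p | p.2 = 0 ∨ (1 ≤ p.2 ∧ p.2 ≤ (excpSet r p.1).card) ∨
        ((excpSet r p.1).card + r - 1 < p.2 ∧ p.2 ≤ n - 1)}

/-- The number of inversions of `f` restricted to the set of positions `S`. -/
def invOn (S : Finset ℕ) (f : ℕ → ℕ) : ℕ :=
  ((S ×ˢ S).filter (fun p => p.1 < p.2 ∧ f p.2 < f p.1)).card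

theorem winv_map_sort (S : Finset ℕ) (f : ℕ → ℕ) :
    winv ((S.sort (· ≤ ·)).map f) = invOn S f := by
  have hs : ∀ a b (ha : a < (S.sort (· ≤ ·)).length) (hb : b < (S.sort (· ≤ ·)).length),
      (S.sort (· ≤ ·))[a] < (S.sort (· ≤ ·))[b] ↔ a < b := by
    intro a b ha hb
    exact (Finset.sortedLT_sort S).strictMono_get.lt_iff_lt (a := ⟨a, ha⟩) (b := ⟨b, hb⟩)
  have hd : ∀ a (ha : a < (S.sort (· ≤ ·)).length),
      ((S.sort (· ≤ ·)).map f).getD a 0 = f ((S.sort (· ≤ ·))[a]) := by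
    intro a ha
    rw [List.getD_eq_getElem _ _ (by simpa using ha), List.getElem_map]
  have hm : ∀ a (ha : a < (S.sort (· ≤ ·)).length), (S.sort (· ≤ ·))[a] ∈ S := fun a ha =>
    (Finset.mem_sort (· ≤ ·)).1 (List.getElem_mem ha)
  unfold winv invOn
  refine Finset.card_bij (fun p _ => ((S.sort (· ≤ ·)).getD p.1 0, (S.sort (· ≤ ·)).getD p.2 0))
    ?_ ?_ ?_
  · rintro ⟨a, b⟩ hab
    simp only [mem_filter, mem_product, mem_range, List.length_map] at hab
    obtain ⟨⟨ha, hb⟩, hlt, hinv⟩ := hab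
    rw [hd a ha, hd b hb] at hinv
    simp only [mem_filter, mem_product]
    rw [List.getD_eq_getElem _ _ ha, List.getD_eq_getElem _ _ hb]
    exact ⟨⟨hm a ha, hm b hb⟩, (hs a b ha hb).2 hlt, hinv⟩
  · rintro ⟨a, b⟩ hab ⟨c, d⟩ hcd h
    simp only [mem_filter, mem_product, mem_range, List.length_map] at hab hcd
    obtain ⟨⟨ha, hb⟩, -⟩ := hab
    obtain ⟨⟨hc, hd'⟩, -⟩ := hcd
    rw [List.getD_eq_getElem _ _ ha, List.getD_eq_getElem _ _ hb,
      List.getD_eq_getElem _ _ hc, List.getD_eq_getElem _ _ hd', Prod.mk.injEq] at h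
    have h1 := hs a c ha hc
    have h2 := hs c a hc ha
    have h3 := hs b d hb hd'
    have h4 := hs d b hd' hb
    rw [Prod.mk.injEq]
    omega
  · rintro ⟨x, y⟩ hxy
    simp only [mem_filter, mem_product] at hxy
    obtain ⟨⟨hx, hy⟩, hlt, hinv⟩ := hxy
    obtain ⟨a, ha, rfl⟩ := List.getElem_of_mem ((Finset.mem_sort (· ≤ ·)).2 hx)
    obtain ⟨b, hb, rfl⟩ := List.getElem_of_mem ((Finset.mem_sort (· ≤ ·)).2 hy)
    refine ⟨(a, b), ?_, ?_⟩
    · simp only [mem_filter, mem_product, mem_range, List.length_map]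
      rw [hd a ha, hd b hb]
      exact ⟨⟨ha, hb⟩, (hs a b ha hb).1 hlt, hinv⟩
    · simp only [List.getD_eq_getElem _ _ ha, List.getD_eq_getElem _ _ hb]

theorem denr_eq {n : ℕ} (r : ℕ) (π : Equiv.Perm (Fin n)) :
    denr r π = (∑ i ∈ excpSet r π, i) + invOn (excpSet r π) (pval π) +
      invOn (Icc 1 n \ excpSet r π) (pval π) := by
  rw [denr, excWord, nexcWord, winv_map_sort, winv_map_sort]

theorem pval_mem {n : ℕ} (π : Equiv.Perm (Fin n)) {i : ℕ} (h1 : 1 ≤ i) (h2 : i ≤ n) :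
    1 ≤ pval π i ∧ pval π i ≤ n := by
  rw [pval, dif_pos ⟨h1, h2⟩]
  omega

theorem pval_injOn {n : ℕ} (π : Equiv.Perm (Fin n)) {i j : ℕ} (h1 : 1 ≤ i) (h2 : i ≤ n)
    (h3 : 1 ≤ j) (h4 : j ≤ n) (h : pval π i = pval π j) : i = j := by
  rw [pval, pval, dif_pos ⟨h1, h2⟩, dif_pos ⟨h3, h4⟩, Nat.add_right_cancel_iff,
    Fin.val_inj, π.injective.eq_iff, Fin.mk.injEq] at h
  omega

theorem perm_ext_pval {n : ℕ} {π σ : Equiv.Perm (Fin n)}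
    (h : ∀ i, 1 ≤ i → i ≤ n → pval π i = pval σ i) : π = σ := by
  ext x
  have hx := h (x + 1) (by omega) (by omega)
  rw [pval, pval, dif_pos (by omega), dif_pos (by omega)] at hx
  simpa using hx

theorem exists_perm_pval {n : ℕ} (g : ℕ → ℕ) (hg : ∀ i, 1 ≤ i → i ≤ n → 1 ≤ g i ∧ g i ≤ n)
    (hinj : ∀ i j, 1 ≤ i → i ≤ n → 1 ≤ j → j ≤ n → g i = g j → i = j) :
    ∃ τ : Equiv.Perm (Fin n), ∀ i, 1 ≤ i → i ≤ n → pval τ i = g i := by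
  have hb : ∀ x : Fin n, g (x + 1) - 1 < n := fun x => by
    have := hg (x + 1) (by omega) (by omega)
    omega
  have hF : Function.Injective (fun x : Fin n => (⟨g (x + 1) - 1, hb x⟩ : Fin n)) := by
    intro x y hxy
    have hx := hg (x + 1) (by omega) (by omega)
    have hy := hg (y + 1) (by omega) (by omega)
    simp only [Fin.mk.injEq] at hxy
    have := hinj (x + 1) (y + 1) (by omega) (by omega) (by omega) (by omega) (by omega)
    omega
  refine ⟨Equiv.ofBijective _ (Finite.injective_iff_bijective.1 hF), fun i h1 h2 => ?_⟩
  have := hg i h1 h2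
  rw [pval, dif_pos ⟨h1, h2⟩]
  simp only [Equiv.ofBijective_apply, Nat.sub_add_cancel h1]
  omega

/-- The excedance letters `≥ i` of the word `f` of length `N`, together with `N + 1`. -/
def excLetters (N i : ℕ) (f : ℕ → ℕ) : Finset ℕ :=
  insert (N + 1) (((Icc 1 N).filter (fun j => i ≤ f j ∧ j < f j)).image f)

/-- Replaces every letter in `W` by the next larger one, and fixes the others. -/
noncomputable def bump (W : Finset ℕ) (v : ℕ) : ℕ :=
  if v ∈ W then sInf {w | w ∈ W ∧ v < w} else v

/-- Shifts the places `≥ i` by one, leaving the place `i` free. -/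
def shift (i j : ℕ) : ℕ := if j < i then j else j + 1

/-- Bumps the letters of `f` along `W` and inserts the least element of `W` at the place `i`. -/
noncomputable def insertAt (W : Finset ℕ) (i : ℕ) (f : ℕ → ℕ) (p : ℕ) : ℕ :=
  if p < i then bump W (f p) else if p = i then sInf {w | w ∈ W} else bump W (f (p - 1))

theorem insertAt_shift (W : Finset ℕ) (i : ℕ) (f : ℕ → ℕ) (j : ℕ) :
    insertAt W i f (shift i j) = bump W (f j) := by
  unfold insertAt shift
  grind

theorem insertAt_self (W : Finset ℕ) (i : ℕ) (f : ℕ → ℕ) :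
    insertAt W i f i = sInf {w | w ∈ W} := by
  simp [insertAt]

theorem bump_of_notMem {W : Finset ℕ} {v : ℕ} (h : v ∉ W) : bump W v = v := if_neg h

theorem bump_spec {W : Finset ℕ} {v u : ℕ} (h : v ∈ W) (hu : u ∈ W) (hvu : v < u) :
    bump W v ∈ W ∧ v < bump W v ∧ ∀ w ∈ W, v < w → bump W v ≤ w := by
  have hne : {w | w ∈ W ∧ v < w}.Nonempty := ⟨u, hu, hvu⟩
  rw [bump, if_pos h]
  exact ⟨(Nat.sInf_mem hne).1, (Nat.sInf_mem hne).2, fun w hw hvw => Nat.sInf_le ⟨hw, hvw⟩⟩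

theorem exists_eq_shift {i p N : ℕ} (h1 : 1 ≤ i) (hi : i ≤ N + 1) (hp : 1 ≤ p)
    (hpN : p ≤ N + 1) (hne : p ≠ i) : ∃ j, 1 ≤ j ∧ j ≤ N ∧ shift i j = p := by
  by_cases h : p < i
  · exact ⟨p, hp, by omega, by simp [shift, h]⟩
  · exact ⟨p - 1, by omega, by omega, by unfold shift; split_ifs <;> omega⟩

theorem shift_injective (i : ℕ) : Function.Injective (shift i) := by
  intro a b h
  unfold shift at h
  split_ifs at h <;> omega

theorem shift_lt_shift {i a b : ℕ} : shift i a < shift i b ↔ a < b := by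
  unfold shift
  split_ifs <;> omega

theorem shift_ne (i j : ℕ) : shift i j ≠ i := by
  unfold shift
  split_ifs <;> omega

section Word

/-- `f` restricts to a permutation of `{1, …, N}`. -/
structure IsPermWord (N : ℕ) (f : ℕ → ℕ) : Prop where
  mem : ∀ j, 1 ≤ j → j ≤ N → 1 ≤ f j ∧ f j ≤ N
  inj : ∀ i j, 1 ≤ i → i ≤ N → 1 ≤ j → j ≤ N → f i = f j → i = j

theorem isPermWord_pval {N : ℕ} (π : Equiv.Perm (Fin N)) : IsPermWord N (pval π) :=
  ⟨fun _ => pval_mem π, fun _ _ => pval_injOn π⟩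

variable {N : ℕ} {f : ℕ → ℕ} {i : ℕ}

theorem IsPermWord.apply_mem_excLetters (hf : IsPermWord N f) {j : ℕ} (h1 : 1 ≤ j) (h2 : j ≤ N) :
    f j ∈ excLetters N i f ↔ i ≤ f j ∧ j < f j := by
  have := hf.mem j h1 h2
  simp only [excLetters, mem_insert, mem_image, mem_filter, mem_Icc]
  constructor
  · rintro (h | ⟨k, ⟨⟨hk1, hk2⟩, h3, h4⟩, hk⟩)
    · omega
    · obtain rfl := hf.inj k j hk1 hk2 h1 h2 hk
      exact ⟨h3, h4⟩
  · exact fun h => Or.inr ⟨j, ⟨⟨h1, h2⟩, h⟩, rfl⟩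

theorem top_mem_excLetters : N + 1 ∈ excLetters N i f := mem_insert_self _ _

theorem IsPermWord.excLetters_le (hf : IsPermWord N f) (hi : i ≤ N + 1) {w : ℕ}
    (hw : w ∈ excLetters N i f) : i ≤ w ∧ w ≤ N + 1 := by
  simp only [excLetters, mem_insert, mem_image, mem_filter, mem_Icc] at hw
  rcases hw with rfl | ⟨k, ⟨⟨hk1, hk2⟩, h3, h4⟩, rfl⟩
  · omega
  · have := hf.mem k hk1 hk2
    omega

theorem sInf_mem_excLetters :
    sInf {w | w ∈ excLetters N i f} ∈ excLetters N i f :=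
  Nat.sInf_mem (s := {w | w ∈ excLetters N i f}) ⟨_, top_mem_excLetters⟩

theorem sInf_excLetters_le {w : ℕ} (hw : w ∈ excLetters N i f) :
    sInf {w | w ∈ excLetters N i f} ≤ w := Nat.sInf_le hw

theorem IsPermWord.le_sInf (hf : IsPermWord N f) (hi : i ≤ N + 1) :
    i ≤ sInf {w | w ∈ excLetters N i f} :=
  (hf.excLetters_le hi sInf_mem_excLetters).1

/-- The bump is injective below any letter of `W`. -/
theorem bump_injOn {W : Finset ℕ} {M a b : ℕ} (hM : M ∈ W) (ha : a < M) (hb : b < M)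
    (h : bump W a = bump W b) : a = b := by
  by_cases haW : a ∈ W <;> by_cases hbW : b ∈ W
  · obtain ⟨a1, a2, a3⟩ := bump_spec haW hM ha
    obtain ⟨b1, b2, b3⟩ := bump_spec hbW hM hb
    rcases lt_trichotomy a b with hab | hab | hab
    · have := a3 b hbW hab
      omega
    · exact hab
    · have := b3 a haW hab
      omega
  · rw [bump_of_notMem hbW] at h
    exact absurd (h ▸ (bump_spec haW hM ha).1) hbW
  · rw [bump_of_notMem haW] at h
    exact absurd (h ▸ (bump_spec hbW hM hb).1) haW
  · rwa [bump_of_notMem haW, bump_of_notMem hbW] at h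

theorem bump_ne_sInf {W : Finset ℕ} {M a : ℕ} (hM : M ∈ W) (ha : a < M) :
    bump W a ≠ sInf {w | w ∈ W} := by
  intro h
  by_cases haW : a ∈ W
  · have h1 := (bump_spec haW hM ha).2.1
    have h2 : sInf {w | w ∈ W} ≤ a := Nat.sInf_le haW
    omega
  · rw [bump_of_notMem haW] at h
    exact haW (h ▸ Nat.sInf_mem (s := {w | w ∈ W}) ⟨M, hM⟩)

theorem IsPermWord.insertAt (hf : IsPermWord N f) (h1 : 1 ≤ i) (hi : i ≤ N + 1) :
    IsPermWord (N + 1) (insertAt (excLetters N i f) i f) := by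
  have hlt : ∀ j, 1 ≤ j → j ≤ N → f j < N + 1 := fun j h1 h2 => by
    have := hf.mem j h1 h2
    omega
  constructor
  · intro p hp hpN
    by_cases hpi : p = i
    · subst hpi
      rw [insertAt_self]
      have := hf.excLetters_le hi (sInf_mem_excLetters (N := N) (i := p) (f := f))
      omega
    · obtain ⟨j, hj1, hj2, rfl⟩ := exists_eq_shift h1 hi hp hpN hpi
      rw [insertAt_shift]
      have hj := hf.mem j hj1 hj2
      by_cases hW : f j ∈ excLetters N i f
      · have h2 := (bump_spec hW top_mem_excLetters (hlt j hj1 hj2)).1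
        have := hf.excLetters_le hi h2
        omega
      · rw [bump_of_notMem hW]
        omega
  · intro p q hp hpN hq hqN hpq
    by_cases hpi : p = i <;> by_cases hqi : q = i
    · omega
    · obtain ⟨j, hj1, hj2, rfl⟩ := exists_eq_shift h1 hi hq hqN hqi
      subst hpi
      rw [insertAt_shift, insertAt_self] at hpq
      exact absurd hpq.symm (bump_ne_sInf top_mem_excLetters (hlt j hj1 hj2))
    · obtain ⟨j, hj1, hj2, rfl⟩ := exists_eq_shift h1 hi hp hpN hpi
      subst hqi
      rw [insertAt_shift, insertAt_self] at hpq
      exact absurd hpq (bump_ne_sInf top_mem_excLetters (hlt j hj1 hj2))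
    · obtain ⟨j, hj1, hj2, rfl⟩ := exists_eq_shift h1 hi hp hpN hpi
      obtain ⟨k, hk1, hk2, rfl⟩ := exists_eq_shift h1 hi hq hqN hqi
      rw [insertAt_shift, insertAt_shift] at hpq
      rw [hf.inj j k hj1 hj2 hk1 hk2
        (bump_injOn top_mem_excLetters (hlt j hj1 hj2) (hlt k hk1 hk2) hpq)]

theorem IsPermWord.image_eq (hf : IsPermWord N f) : (Icc 1 N).image f = Icc 1 N := by
  apply Finset.eq_of_subset_of_card_le
  · intro v hv
    obtain ⟨j, hj, rfl⟩ := mem_image.1 hv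
    rw [mem_Icc] at hj ⊢
    exact hf.mem j hj.1 hj.2
  · rw [Finset.card_image_of_injOn]
    intro a ha b hb hab
    simp only [coe_Icc, Set.mem_Icc] at ha hb
    exact hf.inj a b ha.1 ha.2 hb.1 hb.2 hab

theorem IsPermWord.exists_eq (hf : IsPermWord N f) {v : ℕ} (h1 : 1 ≤ v) (h2 : v ≤ N) :
    ∃ j, 1 ≤ j ∧ j ≤ N ∧ f j = v := by
  have hv : v ∈ (Icc 1 N).image f := by
    rw [hf.image_eq, mem_Icc]
    exact ⟨h1, h2⟩
  obtain ⟨j, hj, rfl⟩ := mem_image.1 hv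
  rw [mem_Icc] at hj
  exact ⟨j, hj.1, hj.2, rfl⟩

/-- As many small letters occur at large places as large letters occur at small places. -/
theorem IsPermWord.card_small_late (hf : IsPermWord N f) (i : ℕ) :
    ((Icc 1 N).filter (fun b => i ≤ b ∧ f b < i)).card =
      ((Icc 1 N).filter (fun a => a < i ∧ i ≤ f a)).card := by
  have h1 : ((Icc 1 N).filter (fun b => f b < i)).card =
      ((Icc 1 N).filter (fun a => a < i)).card := by
    conv_rhs => rw [← hf.image_eq, Finset.filter_image]
    rw [Finset.card_image_of_injOn]
    intro a ha b hb hab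
    simp only [coe_filter, Set.mem_ofPred_eq, mem_Icc] at ha hb
    exact hf.inj a b ha.1.1 ha.1.2 hb.1.1 hb.1.2 hab
  have h2 := Finset.card_filter_add_card_filter_not
    (s := (Icc 1 N).filter (fun b => f b < i)) (fun b => b < i)
  have h3 := Finset.card_filter_add_card_filter_not
    (s := (Icc 1 N).filter (fun b => b < i)) (fun b => f b < i)
  simp only [Finset.filter_filter, not_lt] at h2 h3
  have h4 : (Icc 1 N).filter (fun a => f a < i ∧ i ≤ a) =
    (Icc 1 N).filter (fun b => i ≤ b ∧ f b < i) := by simp only [and_comm]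
  have h5 : (Icc 1 N).filter (fun a => f a < i ∧ a < i) =
    (Icc 1 N).filter (fun b => b < i ∧ f b < i) := by simp only [and_comm]
  rw [h4, h5] at h2
  omega

/-- The `r`-level excedance places of the word `f` of length `N`. -/
def excpOn (r N : ℕ) (f : ℕ → ℕ) : Finset ℕ :=
  (Icc 1 N).filter (fun j => j < f j ∧ r ≤ f j)

/-- `g` is obtained from the word `f` of length `N` by insertion at the place `i`. -/
structure IsInsertion (N i : ℕ) (f g : ℕ → ℕ) : Prop where
  isPermWord : IsPermWord N f
  one_le : 1 ≤ i
  le_succ : i ≤ N + 1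
  shift_eq : ∀ j, 1 ≤ j → j ≤ N → g (shift i j) = bump (excLetters N i f) (f j)
  self_eq : g i = sInf {w | w ∈ excLetters N i f}

variable {g : ℕ → ℕ} {r : ℕ}

namespace IsInsertion

theorem le_self (h : IsInsertion N i f g) : i ≤ g i := by
  rw [h.self_eq]
  exact h.isPermWord.le_sInf h.le_succ

theorem self_eq_iff (h : IsInsertion N i f g) : g i = i ↔ i ∈ excLetters N i f := by
  constructor
  · intro hi
    have := h.self_eq ▸ sInf_mem_excLetters (N := N) (i := i) (f := f)
    rwa [hi] at this
  · intro hi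
    have h1 := h.le_self
    have h2 := sInf_excLetters_le hi
    rw [← h.self_eq] at h2
    omega

theorem apply_lt (h : IsInsertion N i f g) {j : ℕ} (h1 : 1 ≤ j) (h2 : j ≤ N) :
    f j < N + 1 := by
  have := h.isPermWord.mem j h1 h2
  omega

theorem shift_eq_cases (h : IsInsertion N i f g) {j : ℕ} (h1 : 1 ≤ j) (h2 : j ≤ N) :
    (i ≤ f j ∧ j < f j ∧ f j < g (shift i j) ∧ g i ≤ f j) ∨
      ((f j < i ∨ f j ≤ j) ∧ g (shift i j) = f j) := by
  rw [h.shift_eq j h1 h2]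
  by_cases hW : f j ∈ excLetters N i f
  · left
    have h3 := (h.isPermWord.apply_mem_excLetters h1 h2).1 hW
    have h4 := sInf_excLetters_le hW
    rw [← h.self_eq] at h4
    exact ⟨h3.1, h3.2, (bump_spec hW top_mem_excLetters (h.apply_lt h1 h2)).2.1, h4⟩
  · right
    refine ⟨?_, bump_of_notMem hW⟩
    rw [h.isPermWord.apply_mem_excLetters h1 h2] at hW
    omega

theorem shift_le_of_lt (h : IsInsertion N i f g) {j k : ℕ} (h1 : 1 ≤ j) (h2 : j ≤ N)
    (h3 : 1 ≤ k) (h4 : k ≤ N) (hj : i ≤ f j ∧ j < f j) (hk : i ≤ f k ∧ k < f k)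
    (hlt : f j < f k) : g (shift i j) ≤ f k := by
  rw [h.shift_eq j h1 h2]
  exact (bump_spec ((h.isPermWord.apply_mem_excLetters h1 h2).2 hj) top_mem_excLetters
    (h.apply_lt h1 h2)).2.2 _ ((h.isPermWord.apply_mem_excLetters h3 h4).2 hk) hlt

theorem mem_excLetters_iff (h : IsInsertion N i f g) (hg : IsPermWord (N + 1) g) (w : ℕ) :
    w ∈ excLetters N i f ↔
      w = g i ∨ (i < w ∧ ∃ p, 1 ≤ p ∧ p ≤ N + 1 ∧ p < w ∧ g p = w) := by
  constructor
  · intro hw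
    have hb := h.isPermWord.excLetters_le h.le_succ hw
    obtain ⟨p, hp1, hp2, rfl⟩ := hg.exists_eq (v := w) (h.one_le.trans hb.1) hb.2
    by_cases hpi : p = i
    · exact Or.inl (by rw [hpi])
    · right
      obtain ⟨j, hj1, hj2, rfl⟩ := exists_eq_shift h.one_le h.le_succ hp1 hp2 hpi
      have hs : shift i j ≤ j + 1 := by
        unfold shift
        split_ifs <;> omega
      rcases h.shift_eq_cases hj1 hj2 with hc | ⟨hc, heq⟩
      · exact ⟨by omega, _, hp1, hp2, by omega, rfl⟩
      · rw [heq, h.isPermWord.apply_mem_excLetters hj1 hj2] at hw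
        omega
  · rintro (rfl | ⟨hiw, p, hp1, hp2, hpw, rfl⟩)
    · rw [h.self_eq]
      exact sInf_mem_excLetters
    · by_cases hpi : p = i
      · rw [hpi, h.self_eq]
        exact sInf_mem_excLetters
      · obtain ⟨j, hj1, hj2, rfl⟩ := exists_eq_shift h.one_le h.le_succ hp1 hp2 hpi
        have hs : j ≤ shift i j := by
          unfold shift
          split_ifs <;> omega
        by_cases hW : f j ∈ excLetters N i f
        · rw [h.shift_eq j hj1 hj2]
          exact (bump_spec hW top_mem_excLetters (h.apply_lt hj1 hj2)).1
        · have heq := h.shift_eq j hj1 hj2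
          rw [bump_of_notMem hW] at heq
          rw [h.isPermWord.apply_mem_excLetters hj1 hj2] at hW
          omega

theorem eq_of_eq {f' : ℕ → ℕ} (h : IsInsertion N i f g) (h' : IsInsertion N i f' g)
    (hg : IsPermWord (N + 1) g) {j : ℕ} (h1 : 1 ≤ j) (h2 : j ≤ N) : f j = f' j := by
  have hW : excLetters N i f = excLetters N i f' := by
    ext w
    rw [h.mem_excLetters_iff hg, h'.mem_excLetters_iff hg]
  have h3 := h.shift_eq j h1 h2
  rw [h'.shift_eq j h1 h2, hW] at h3
  exact (bump_injOn top_mem_excLetters (h'.apply_lt h1 h2) (h.apply_lt h1 h2) h3).symm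

theorem shift_mem_excpOn (h : IsInsertion N i f g) (hr : r ≤ i) {j : ℕ} (h1 : 1 ≤ j)
    (h2 : j ≤ N) : shift i j < g (shift i j) ∧ r ≤ g (shift i j) ↔ j < f j ∧ r ≤ f j := by
  have hc := h.shift_eq_cases h1 h2
  have hs : shift i j = if j < i then j else j + 1 := rfl
  split_ifs at hs <;> omega

theorem Icc_eq (h1 : 1 ≤ i) (h2 : i ≤ N + 1) :
    Icc 1 (N + 1) = insert i ((Icc 1 N).image (shift i)) := by
  ext p
  simp only [mem_insert, mem_image, mem_Icc]
  constructor
  · rintro ⟨hp1, hp2⟩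
    by_cases hpi : p = i
    · exact Or.inl hpi
    · obtain ⟨j, hj1, hj2, rfl⟩ := exists_eq_shift h1 h2 hp1 hp2 hpi
      exact Or.inr ⟨j, ⟨hj1, hj2⟩, rfl⟩
  · rintro (rfl | ⟨j, hj, rfl⟩)
    · exact ⟨h1, h2⟩
    · unfold shift
      split_ifs <;> omega

theorem filter_shift (h1 : 1 ≤ i) (h2 : i ≤ N + 1) (P Q : ℕ → Prop) [DecidablePred P]
    [DecidablePred Q] (hPQ : ∀ j, 1 ≤ j → j ≤ N → (P (shift i j) ↔ Q j)) :
    (Icc 1 (N + 1)).filter P = if P i then insert i (((Icc 1 N).filter Q).image (shift i)) else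
      ((Icc 1 N).filter Q).image (shift i) := by
  have h3 : ((Icc 1 N).image (shift i)).filter P = ((Icc 1 N).filter Q).image (shift i) := by
    rw [Finset.filter_image]
    congr 1
    apply Finset.filter_congr
    intro j hj
    rw [mem_Icc] at hj
    exact hPQ j hj.1 hj.2
  rw [Icc_eq h1 h2, Finset.filter_insert, h3]

theorem notMem_image_shift (S : Finset ℕ) : i ∉ S.image (shift i) := by
  intro h
  obtain ⟨j, -, hj⟩ := mem_image.1 h
  exact shift_ne i j hj

end IsInsertion

theorem invOn_eq_sum (S : Finset ℕ) (f : ℕ → ℕ) :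
    invOn S f = ∑ a ∈ S, ∑ b ∈ S, if a < b ∧ f b < f a then 1 else 0 := by
  rw [invOn, Finset.card_filter, Finset.sum_product]

theorem invOn_image_shift (S : Finset ℕ) (i : ℕ) (g : ℕ → ℕ) :
    invOn (S.image (shift i)) g = invOn S (fun j => g (shift i j)) := by
  simp only [invOn_eq_sum, Finset.sum_image (shift_injective i).injOn, shift_lt_shift]

theorem invOn_insert_image_shift (S : Finset ℕ) (i : ℕ) (g : ℕ → ℕ) :
    invOn (insert i (S.image (shift i))) g = invOn S (fun j => g (shift i j)) +
      (S.filter (fun a => a < i ∧ g i < g (shift i a))).card +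
      (S.filter (fun b => i ≤ b ∧ g (shift i b) < g i)).card := by
  have h1 : ∀ a, shift i a < i ↔ a < i := fun a => by
    unfold shift
    split_ifs <;> omega
  have h2 : ∀ a, i < shift i a ↔ i ≤ a := fun a => by
    unfold shift
    split_ifs <;> omega
  simp only [invOn_eq_sum, Finset.sum_insert (IsInsertion.notMem_image_shift S),
    Finset.sum_image (shift_injective i).injOn, shift_lt_shift, Finset.sum_add_distrib,
    Finset.card_filter, h1, h2, lt_irrefl, false_and, if_false]
  omega

theorem invOn_congr {S : Finset ℕ} {f f' : ℕ → ℕ}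
    (h : ∀ a ∈ S, ∀ b ∈ S, a < b → (f b < f a ↔ f' b < f' a)) : invOn S f = invOn S f' := by
  unfold invOn
  congr 1
  apply Finset.filter_congr
  rintro ⟨a, b⟩ hab
  rw [mem_product] at hab
  have := h a hab.1 b hab.2
  dsimp only
  tauto

theorem sum_image_shift (S : Finset ℕ) (i : ℕ) :
    ∑ p ∈ S.image (shift i), p = ∑ j ∈ S, j + (S.filter (fun j => i ≤ j)).card := by
  rw [Finset.sum_image (shift_injective i).injOn, Finset.card_filter, ← Finset.sum_add_distrib]
  apply Finset.sum_congr rfl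
  intro j _
  unfold shift
  split_ifs <;> omega

namespace IsInsertion

theorem card_exc (h : IsInsertion N i f g) (hr : r ≤ i) :
    ((Icc 1 (N + 1)).filter (fun j => r ≤ j ∧ j < g j)).card =
      ((Icc 1 N).filter (fun j => r ≤ j ∧ j < f j)).card + if i < g i then 1 else 0 := by
  rw [filter_shift h.one_le h.le_succ (fun j => r ≤ j ∧ j < g j) (fun j => r ≤ j ∧ j < f j)]
  · simp only [hr, true_and]
    split_ifs
    · rw [card_insert_of_notMem (notMem_image_shift _),
        card_image_of_injective _ (shift_injective i)]
    · rw [card_image_of_injective _ (shift_injective i), add_zero]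
  · intro j h1 h2
    have hc := h.shift_eq_cases h1 h2
    have hs : shift i j = if j < i then j else j + 1 := rfl
    split_ifs at hs <;> omega

theorem excpOn_eq (h : IsInsertion N i f g) (hr : r ≤ i) :
    excpOn r (N + 1) g = if i < g i then insert i ((excpOn r N f).image (shift i)) else
      (excpOn r N f).image (shift i) := by
  have := h.le_self
  rw [excpOn, filter_shift h.one_le h.le_succ (fun j => j < g j ∧ r ≤ g j)
    (fun j => j < f j ∧ r ≤ f j) (fun j => h.shift_mem_excpOn hr)]
  congr 1
  rw [eq_iff_iff]
  omega

theorem sdiff_excpOn_eq (h : IsInsertion N i f g) (hr : r ≤ i) :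
    Icc 1 (N + 1) \ excpOn r (N + 1) g =
      if i < g i then (Icc 1 N \ excpOn r N f).image (shift i) else
      insert i ((Icc 1 N \ excpOn r N f).image (shift i)) := by
  have := h.le_self
  rw [excpOn, excpOn, ← Finset.filter_not, ← Finset.filter_not,
    filter_shift h.one_le h.le_succ (fun j => ¬ (j < g j ∧ r ≤ g j))
    (fun j => ¬ (j < f j ∧ r ≤ f j)) (fun j h1 h2 => not_congr (h.shift_mem_excpOn hr h1 h2))]
  rw [← ite_not]
  congr 1
  rw [eq_iff_iff]
  omega

theorem mem_excpOn {j : ℕ} : j ∈ excpOn r N f ↔ (1 ≤ j ∧ j ≤ N) ∧ j < f j ∧ r ≤ f j := by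
  rw [excpOn, mem_filter, mem_Icc]

theorem mem_sdiff_excpOn {j : ℕ} :
    j ∈ Icc 1 N \ excpOn r N f ↔ (1 ≤ j ∧ j ≤ N) ∧ (f j ≤ j ∨ f j < r) := by
  rw [mem_sdiff, mem_excpOn, mem_Icc]
  omega

theorem invOn_excpOn (h : IsInsertion N i f g) :
    invOn (excpOn r N f) (fun j => g (shift i j)) = invOn (excpOn r N f) f := by
  apply invOn_congr
  intro a ha b hb hab
  rw [mem_excpOn] at ha hb
  have hne : f a ≠ f b := fun he => by
    have := h.isPermWord.inj a b ha.1.1 ha.1.2 hb.1.1 hb.1.2 he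
    omega
  have h1 := h.shift_eq_cases ha.1.1 ha.1.2
  have h2 := h.shift_eq_cases hb.1.1 hb.1.2
  have h3 := h.shift_le_of_lt ha.1.1 ha.1.2 hb.1.1 hb.1.2
  have h4 := h.shift_le_of_lt hb.1.1 hb.1.2 ha.1.1 ha.1.2
  omega

theorem invOn_sdiff_excpOn (h : IsInsertion N i f g) (hr : r ≤ i) :
    invOn (Icc 1 N \ excpOn r N f) (fun j => g (shift i j)) =
      invOn (Icc 1 N \ excpOn r N f) f := by
  apply invOn_congr
  intro a ha b hb hab
  rw [mem_sdiff_excpOn] at ha hb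
  have h1 := h.shift_eq_cases ha.1.1 ha.1.2
  have h2 := h.shift_eq_cases hb.1.1 hb.1.2
  omega

theorem card_excpOn_split (hr : r ≤ i) :
    ((excpOn r N f).filter (fun j => i ≤ j)).card +
      ((Icc 1 N).filter (fun a => a < i ∧ i ≤ f a)).card =
      ((excpOn r N f).filter (fun j => i ≤ f j)).card := by
  have h1 := Finset.card_filter_add_card_filter_not
    (s := (excpOn r N f).filter (fun j => i ≤ f j)) (fun j => i ≤ j)
  rw [← h1]
  congr 2
  · ext j
    simp only [mem_filter, mem_excpOn]
    omega
  · ext j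
    simp only [mem_filter, mem_excpOn, mem_Icc]
    omega

/-- The effect of an insertion on the Denert statistic. -/
theorem den_eq (h : IsInsertion N i f g) (hr : r ≤ i) :
    ∑ p ∈ excpOn r (N + 1) g, p + invOn (excpOn r (N + 1) g) g +
        invOn (Icc 1 (N + 1) \ excpOn r (N + 1) g) g =
      (∑ p ∈ excpOn r N f, p + invOn (excpOn r N f) f + invOn (Icc 1 N \ excpOn r N f) f) +
        ((if i < g i then i else 0) + ((excpOn r N f).filter (fun j => i ≤ f j)).card) := by
  rw [h.sdiff_excpOn_eq hr, h.excpOn_eq hr,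
    ← card_excpOn_split hr]
  split_ifs with hi
  · rw [Finset.sum_insert (notMem_image_shift _), sum_image_shift, invOn_insert_image_shift,
      invOn_image_shift, h.invOn_excpOn, h.invOn_sdiff_excpOn hr]
    have h1 : (excpOn r N f).filter (fun a => a < i ∧ g i < g (shift i a)) =
        (Icc 1 N).filter (fun a => a < i ∧ i ≤ f a) := by
      ext a
      simp only [mem_filter, mem_excpOn, mem_Icc]
      by_cases ha : 1 ≤ a ∧ a ≤ N
      · have hc := h.shift_eq_cases ha.1 ha.2
        omega
      · tauto
    have h2 : (excpOn r N f).filter (fun b => i ≤ b ∧ g (shift i b) < g i) = ∅ := by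
      apply Finset.filter_false_of_mem
      intro b hb
      rw [mem_excpOn] at hb
      have hc := h.shift_eq_cases hb.1.1 hb.1.2
      omega
    rw [h1, h2, card_empty]
    omega
  · have hgi : g i = i := le_antisymm (not_lt.1 hi) h.le_self
    rw [sum_image_shift, invOn_insert_image_shift,
      invOn_image_shift, h.invOn_excpOn, h.invOn_sdiff_excpOn hr]
    have h1 : (Icc 1 N \ excpOn r N f).filter (fun a => a < i ∧ g i < g (shift i a)) = ∅ := by
      apply Finset.filter_false_of_mem
      intro b hb
      rw [mem_sdiff_excpOn] at hb
      have hc := h.shift_eq_cases hb.1.1 hb.1.2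
      omega
    have h2 : (Icc 1 N \ excpOn r N f).filter (fun b => i ≤ b ∧ g (shift i b) < g i) =
        (Icc 1 N).filter (fun b => i ≤ b ∧ f b < i) := by
      ext a
      simp only [mem_filter, mem_sdiff_excpOn]
      rw [mem_Icc]
      by_cases ha : 1 ≤ a ∧ a ≤ N
      · have hc := h.shift_eq_cases ha.1 ha.2
        omega
      · tauto
    rw [h1, h2, card_empty, h.isPermWord.card_small_late]
    omega

end IsInsertion

theorem exists_crossing {P : ℕ → Prop} {a b : ℕ} (hab : a ≤ b) (ha : P a) (hb : ¬ P b) :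
    ∃ i, a ≤ i ∧ i < b ∧ P i ∧ ¬ P (i + 1) := by
  induction b, hab using Nat.le_induction with
  | base => exact absurd ha hb
  | succ k hk ih =>
    by_cases hP : P k
    · exact ⟨k, hk, by omega, hP, hb⟩
    · obtain ⟨i, h1, h2, h3⟩ := ih hP
      exact ⟨i, h1, by omega, h3⟩

theorem mem_excLetters_self (hi : i ≤ N) :
    i ∈ excLetters N i f ↔ ∃ j, 1 ≤ j ∧ j ≤ N ∧ j < i ∧ f j = i := by
  simp only [excLetters, mem_insert, mem_image, mem_filter, mem_Icc]
  constructor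
  · rintro (h | ⟨j, ⟨⟨h1, h2⟩, h3, h4⟩, h5⟩)
    · omega
    · exact ⟨j, h1, h2, by omega, h5⟩
  · rintro ⟨j, h1, h2, h3, h4⟩
    exact Or.inr ⟨j, ⟨⟨h1, h2⟩, by omega, by omega⟩, h4⟩

theorem IsPermWord.card_letters_succ (hf : IsPermWord N f) (h1 : 1 ≤ i) (hr : r ≤ i)
    (hi : i ≤ N) : ((excpOn r N f).filter (fun j => i ≤ f j)).card =
      ((excpOn r N f).filter (fun j => i + 1 ≤ f j)).card +
        if i ∈ excLetters N i f then 1 else 0 := by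
  obtain ⟨k, hk1, hk2, hk⟩ := hf.exists_eq h1 hi
  have h2 := Finset.card_filter_add_card_filter_not
    (s := (excpOn r N f).filter (fun j => i ≤ f j)) (fun j => i + 1 ≤ f j)
  rw [← h2]
  congr 1
  · congr 1
    ext j
    simp only [mem_filter]
    constructor
    · rintro ⟨⟨h3, -⟩, h4⟩
      exact ⟨h3, h4⟩
    · rintro ⟨h3, h4⟩
      exact ⟨⟨h3, by omega⟩, h4⟩
  · have h3 : ∀ j, 1 ≤ j → j ≤ N → f j = i → j = k := fun j hj1 hj2 hj =>
      hf.inj j k hj1 hj2 hk1 hk2 (hj.trans hk.symm)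
    split_ifs with hW <;> rw [mem_excLetters_self hi] at hW
    · obtain ⟨j, hj1, hj2, hj3, hj4⟩ := hW
      obtain rfl := h3 j hj1 hj2 hj4
      rw [Finset.card_eq_one]
      refine ⟨j, ?_⟩
      ext l
      simp only [mem_filter, IsInsertion.mem_excpOn, mem_singleton]
      constructor
      · intro hl
        exact h3 l hl.1.1.1.1 hl.1.1.1.2 (by omega)
      · rintro rfl
        omega
    · rw [Finset.card_eq_zero]
      apply Finset.filter_false_of_mem
      intro l hl hl2
      simp only [mem_filter, IsInsertion.mem_excpOn] at hl
      exact hW ⟨l, hl.1.1.1, hl.1.1.2, by omega, by omega⟩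

/-- Every admissible increment `c` is realized by an insertion place. -/
theorem IsPermWord.exists_place (hf : IsPermWord N f) (hr : 1 ≤ r) (hrN : r ≤ N) {c : ℕ}
    (hc : c = 0 ∨ (1 ≤ c ∧ c ≤ (excpOn r N f).card) ∨
      ((excpOn r N f).card + r - 1 < c ∧ c ≤ N)) :
    ∃ i, r ≤ i ∧ i ≤ N + 1 ∧
      ((i ∈ excLetters N i f ∧ c = ((excpOn r N f).filter (fun j => i ≤ f j)).card ∧
          c ≤ (excpOn r N f).card) ∨
        (i ∉ excLetters N i f ∧ c = i + ((excpOn r N f).filter (fun j => i ≤ f j)).card ∧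
          (excpOn r N f).card + r ≤ c)) := by
  have htop : ((excpOn r N f).filter (fun j => N + 1 ≤ f j)).card = 0 := by
    rw [Finset.card_eq_zero]
    apply Finset.filter_false_of_mem
    intro j hj
    rw [IsInsertion.mem_excpOn] at hj
    have := hf.mem j hj.1.1 hj.1.2
    omega
  have hbot : (excpOn r N f).filter (fun j => r ≤ f j) = excpOn r N f := by
    apply Finset.filter_true_of_mem
    intro j hj
    rw [IsInsertion.mem_excpOn] at hj
    exact hj.2.2
  rcases hc with rfl | ⟨hc1, hc2⟩ | ⟨hc1, hc2⟩
  · exact ⟨N + 1, by omega, le_rfl, Or.inl ⟨top_mem_excLetters, htop.symm, by omega⟩⟩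
  · obtain ⟨i, h1, h2, h3, h4⟩ := exists_crossing (a := r) (b := N + 1)
      (P := fun i => c ≤ ((excpOn r N f).filter (fun j => i ≤ f j)).card)
      (by omega) (by rwa [hbot]) (by rw [htop]; omega)
    have h5 := hf.card_letters_succ (i := i) (r := r) (by omega) h1 (by omega)
    split_ifs at h5 with hW
    · exact ⟨i, h1, by omega, Or.inl ⟨hW, by omega, hc2⟩⟩
    · omega
  · obtain ⟨i, h1, h2, h3, h4⟩ := exists_crossing (a := r) (b := N + 1)
      (P := fun i => i + ((excpOn r N f).filter (fun j => i ≤ f j)).card ≤ c)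
      (by omega) (by rw [hbot]; omega) (by rw [htop]; omega)
    have h5 := hf.card_letters_succ (i := i) (r := r) (by omega) h1 (by omega)
    split_ifs at h5 with hW
    · omega
    · exact ⟨i, h1, by omega, Or.inr ⟨hW, by omega, by omega⟩⟩

theorem card_excpOn_le (N : ℕ) (f : ℕ → ℕ) (hr : 1 ≤ r) :
    (excpOn r N f).card ≤ ((Icc 1 N).filter (fun j => r ≤ j ∧ j < f j)).card + (r - 1) := by
  have h1 : excpOn r N f ⊆ (Icc 1 N).filter (fun j => r ≤ j ∧ j < f j) ∪ Icc 1 (r - 1) := by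
    intro j hj
    rw [IsInsertion.mem_excpOn] at hj
    simp only [mem_union, mem_filter, mem_Icc]
    omega
  have h2 := (Finset.card_le_card h1).trans (Finset.card_union_le _ _)
  rwa [Nat.card_Icc, Nat.add_sub_cancel] at h2

theorem card_exc_le (r N : ℕ) (f : ℕ → ℕ) :
    ((Icc 1 N).filter (fun j => r ≤ j ∧ j < f j)).card ≤ (excpOn r N f).card := by
  apply Finset.card_le_card
  intro j hj
  rw [IsInsertion.mem_excpOn]
  simp only [mem_filter, mem_Icc] at hj
  omega

namespace IsInsertion

variable {τ : Equiv.Perm (Fin (N + 1))}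

theorem grandeFixedPlace_self (h : IsInsertion N i f (pval τ)) : grandeFixedPlace τ i := by
  refine ⟨h.one_le, h.le_succ, ?_⟩
  have h1 := h.le_self
  rcases h1.eq_or_lt with h2 | h2
  · exact Or.inl h2.symm
  · refine Or.inr ⟨h2, fun p hp1 hp2 hp3 hp4 => ?_⟩
    by_cases hpi : p = i
    · subst hpi
      omega
    · obtain ⟨j, hj1, hj2, rfl⟩ := exists_eq_shift h.one_le h.le_succ hp1 hp2 hpi
      have hs : shift i j = if j < i then j else j + 1 := rfl
      have hc := h.shift_eq_cases hj1 hj2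
      split_ifs at hs <;> omega

theorem le_of_grandeFixedPlace (h : IsInsertion N i f (pval τ)) {p : ℕ}
    (hp : grandeFixedPlace τ p) : p ≤ i := by
  obtain ⟨hp1, hp2, hp⟩ := hp
  by_contra! hip
  obtain ⟨j, hj1, hj2, rfl⟩ := exists_eq_shift h.one_le h.le_succ hp1 hp2 (by omega)
  have hs : shift i j = j + 1 := by
    unfold shift at hip ⊢
    split_ifs at hip ⊢ <;> omega
  have hij : i ≤ j := by omega
  rcases h.shift_eq_cases hj1 hj2 with hc | hc
  · rcases hp with hp | ⟨-, hp⟩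
    · omega
    · have hb := h.isPermWord.mem j hj1 hj2
      obtain ⟨q, hq1, hq2, hq⟩ := (isPermWord_pval τ).exists_eq (v := f j) hb.1 (by omega)
      refine hp q hq1 hq2 ?_ (by omega)
      rw [hq]
      by_cases hqi : q = i
      · omega
      · obtain ⟨k, hk1, hk2, rfl⟩ := exists_eq_shift h.one_le h.le_succ hq1 hq2 hqi
        have hk : shift i k ≤ k + 1 := by
          unfold shift
          split_ifs <;> omega
        rcases h.shift_eq_cases hk1 hk2 with hc' | hc'
        · omega
        · have := h.isPermWord.inj k j hk1 hk2 hj1 hj2 (by omega)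
          subst this
          omega
  · rcases hp with hp | ⟨hp, -⟩ <;> omega

end IsInsertion

end Word

theorem exists_insertion {N r : ℕ} (hr : 1 ≤ r) (hrN : r ≤ N)
    (p : Equiv.Perm (Fin N) × ℕ) (hp : p ∈ Znr (N + 1) r) :
    ∃ (τ : Equiv.Perm (Fin (N + 1))) (i : ℕ), r ≤ i ∧
      IsInsertion N i (pval p.1) (pval τ) ∧
      (p.2 ≤ excr r p.1 + r - 1 → excr r τ = excr r p.1) ∧
      (excr r p.1 + r - 1 < p.2 → excr r τ = excr r p.1 + 1) ∧
      denr r τ = denr r p.1 + p.2 := by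
  obtain ⟨π, c⟩ := p
  have hf := isPermWord_pval π
  obtain ⟨i, hri, hi, hc⟩ := hf.exists_place hr hrN (c := c) hp
  have h1 : 1 ≤ i := hr.trans hri
  have hg := hf.insertAt h1 hi
  obtain ⟨τ, hτ⟩ := exists_perm_pval _ hg.mem hg.inj
  have hins : IsInsertion N i (pval π) (pval τ) := by
    refine ⟨hf, h1, hi, fun j hj1 hj2 => ?_, ?_⟩
    · rw [hτ, insertAt_shift] <;> unfold shift <;> split_ifs <;> omega
    · rw [hτ i h1 hi, insertAt_self]
  have hle := hins.le_self
  have hself := hins.self_eq_iff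
  have hden : denr r τ = denr r π + ((if i < pval τ i then i else 0) +
      ((excpOn r N (pval π)).filter (fun j => i ≤ pval π j)).card) := by
    rw [denr_eq, denr_eq]
    exact hins.den_eq hri
  have hexc : excr r τ = excr r π + if i < pval τ i then 1 else 0 := hins.card_exc hri
  have hcard : (excpOn r N (pval π)).card ≤ excr r π + (r - 1) :=
    card_excpOn_le N (pval π) hr
  have hcard' : excr r π ≤ (excpOn r N (pval π)).card := card_exc_le r N (pval π)
  refine ⟨τ, i, hri, hins, ?_⟩
  dsimp only
  rcases hc with ⟨hW, hc⟩ | ⟨hW, hc⟩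
  · have hnlt : ¬ i < pval τ i := (hself.2 hW).le.not_gt
    rw [if_neg hnlt] at hden hexc
    exact ⟨fun _ => hexc, fun _ => by omega, by omega⟩
  · have hlt : i < pval τ i := lt_of_le_of_ne hle fun he => hW (hself.1 he.symm)
    rw [if_pos hlt] at hden hexc
    exact ⟨fun _ => by omega, fun _ => hexc, by omega⟩

/-- For 1 ≤ r < n there is an injection ψ from Z_{n,r} into
S_n ∖ S_{n,r} (every image has an r-level grande-fixed place) such that
exc_r(ψ(π,c)) = exc_r(π) if c ≤ exc_r(π) + r - 1 and
exc_r(ψ(π,c)) = exc_r(π) + 1 otherwise, and den_r(ψ(π,c)) = den_r(π) + c. -/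
theorem exists_injection_psi (n r : ℕ) (hr : 1 ≤ r) (hrn : r < n) :
    ∃ ψ : Equiv.Perm (Fin (n - 1)) × ℕ → Equiv.Perm (Fin n),
      Set.InjOn ψ (Znr n r) ∧
      Set.MapsTo ψ (Znr n r) ((Snr n r)ᶜ) ∧
      ∀ p ∈ Znr n r,
        (p.2 ≤ excr r p.1 + r - 1 → excr r (ψ p) = excr r p.1) ∧
        (excr r p.1 + r - 1 < p.2 → excr r (ψ p) = excr r p.1 + 1) ∧
        denr r (ψ p) = denr r p.1 + p.2 := by
  obtain ⟨N, rfl⟩ : ∃ N, n = N + 1 := ⟨n - 1, by omega⟩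
  have key := exists_insertion hr (Nat.lt_succ_iff.1 hrn)
  choose! ψ i hri hins hstat using key
  refine ⟨ψ, ?_, ?_, hstat⟩
  · intro p hp q hq hpq
    have hp' := hins p hp
    have hq' := hins q hq
    have hi : i p = i q := le_antisymm
      (hq'.le_of_grandeFixedPlace (hpq ▸ hp'.grandeFixedPlace_self))
      (hp'.le_of_grandeFixedPlace (hpq ▸ hq'.grandeFixedPlace_self))
    rw [hpq, hi] at hp'
    have h1 : p.1 = q.1 := perm_ext_pval fun j hj1 hj2 =>
      hp'.eq_of_eq hq' (isPermWord_pval _) hj1 hj2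
    have h2 := (hstat p hp).2.2
    rw [hpq, (hstat q hq).2.2, h1] at h2
    exact Prod.ext h1 (by omega)
  · intro p hp hmem
    exact hmem ⟨i p, hri p hp, (hins p hp).grandeFixedPlace_self⟩
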